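/- In B₅, let ψ₁ = σ₃⁻¹σ₂σ₁²σ₂σ₄³σ₃σ₂ and ψ₂ = σ₄⁻¹σ₃σ₂σ₁⁻²σ₂σ₁²σ₂²σ₁σ₄⁵, and set a = ψ₁⁻¹σ₄ψ₁ and b = ψ₂⁻¹(σ₄σ₃σ₂σ₁²σ₂σ₃σ₄)ψ₂. Then for any group homomorphism ρ : B₅ → GL₄(ℤ[t,t⁻¹]) sending each Artin generator σ_i to the i-th reduced Burau matrix B_i, the matrices ρ(a) and ρ(b) commute in GL₄(ℤ[t,t⁻¹]), even though a and b do not commute in B₅. -/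

import Mathlib

open LaurentPolynomial

/-- The ring `Λ = ℤ[t,t⁻¹]` of Laurent polynomials over `ℤ`. -/
abbrev Λ : Type := LaurentPolynomial ℤ

/-- The braid relations on `m` generators `σ_1, …, σ_m` (indexed here by `Fin m`,
with index `i : Fin m` corresponding to the Artin generator `σ_{i+1}`). -/
def braidRels (m : ℕ) : Set (FreeGroup (Fin m)) :=
  { r | (∃ i j : Fin m, (i : ℕ) + 2 ≤ (j : ℕ) ∧
          r = FreeGroup.of i * FreeGroup.of j * (FreeGroup.of i)⁻¹ * (FreeGroup.of j)⁻¹) ∨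
        (∃ i j : Fin m, (i : ℕ) + 1 = (j : ℕ) ∧
          r = FreeGroup.of i * FreeGroup.of j * FreeGroup.of i *
              (FreeGroup.of j * FreeGroup.of i * FreeGroup.of j)⁻¹) }

/-- The braid group `B_n`, presented on `n - 1` generators with the braid relations. -/
abbrev BraidGroup (n : ℕ) : Type := PresentedGroup (braidRels (n - 1))

/-- The Artin generator: `σ i` corresponds to the classical `σ_{i+1}` (0-indexed). -/
def σ {n : ℕ} (i : Fin (n - 1)) : BraidGroup n := PresentedGroup.of i

/-- The `i`-th reduced Burau matrix (0-indexed: `burauMatrix m i` is the matrix `B_{i+1}`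
of the classical generator `σ_{i+1}`): it agrees with the identity except in row `i`,
where the entries are `t` in column `i-1`, `-t` in column `i`, `1` in column `i+1`. -/
noncomputable def burauMatrix (m : ℕ) (i : Fin m) : Matrix (Fin m) (Fin m) Λ :=
  fun r c =>
    if r = i then
      if (c : ℕ) + 1 = (i : ℕ) then T 1
      else if c = i then - T 1
      else if (c : ℕ) = (i : ℕ) + 1 then 1
      else 0
    else if r = c then 1 else 0

/-- The classical Artin generators `σ₁, σ₂, σ₃, σ₄` of `B₅`. -/
def s₁ : BraidGroup 5 := σ ⟨0, by norm_num⟩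
def s₂ : BraidGroup 5 := σ ⟨1, by norm_num⟩
def s₃ : BraidGroup 5 := σ ⟨2, by norm_num⟩
def s₄ : BraidGroup 5 := σ ⟨3, by norm_num⟩

/-- `ψ₁ = σ₃⁻¹ σ₂ σ₁² σ₂ σ₄³ σ₃ σ₂`. -/
def ψ₁ : BraidGroup 5 := s₃⁻¹ * s₂ * s₁ ^ 2 * s₂ * s₄ ^ 3 * s₃ * s₂

/-- `ψ₂ = σ₄⁻¹ σ₃ σ₂ σ₁⁻² σ₂ σ₁² σ₂² σ₁ σ₄⁵`. -/
def ψ₂ : BraidGroup 5 := s₄⁻¹ * s₃ * s₂ * (s₁ ^ 2)⁻¹ * s₂ * s₁ ^ 2 * s₂ ^ 2 * s₁ * s₄ ^ 5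

/-- `a = ψ₁⁻¹ σ₄ ψ₁`. -/
def a : BraidGroup 5 := ψ₁⁻¹ * s₄ * ψ₁

/-- `b = ψ₂⁻¹ (σ₄ σ₃ σ₂ σ₁² σ₂ σ₃ σ₄) ψ₂`. -/
def b : BraidGroup 5 := ψ₂⁻¹ * (s₄ * s₃ * s₂ * s₁ ^ 2 * s₂ * s₃ * s₄) * ψ₂
/-- The elementary Hurwitz move, replacing `(xᵢ, xᵢ₊₁)` by `(xᵢ xᵢ₊₁ xᵢ⁻¹, xᵢ)`. -/
def hurwitz {G : Type*} [Group G] {m : ℕ} (i : Fin m) : Equiv.Perm (Fin (m + 1) → G) where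
  toFun x k := if k = i.castSucc then x i.castSucc * x i.succ * (x i.castSucc)⁻¹
    else if k = i.succ then x i.castSucc else x k
  invFun x k := if k = i.castSucc then x i.succ
    else if k = i.succ then (x i.succ)⁻¹ * x i.castSucc * x i.succ else x k
  left_inv x := by
    ext k
    by_cases h : k = i.castSucc <;> by_cases h' : k = i.succ <;>
      simp_all [mul_assoc, Fin.castSucc_lt_succ.ne']
  right_inv x := by
    ext k
    by_cases h : k = i.castSucc <;> by_cases h' : k = i.succ <;>
      simp_all [mul_assoc, Fin.castSucc_lt_succ.ne']

theorem hurwitz_comm {G : Type*} [Group G] {m : ℕ} {i j : Fin m} (h : (i : ℕ) + 2 ≤ j) :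
    hurwitz (G := G) i * hurwitz j = hurwitz j * hurwitz i := by
  ext x k
  simp only [Equiv.Perm.mul_apply, hurwitz, Equiv.coe_fn_mk, Fin.ext_iff, Fin.val_castSucc,
    Fin.val_succ]
  grind

theorem hurwitz_braid {G : Type*} [Group G] {m : ℕ} {i j : Fin m} (h : (i : ℕ) + 1 = j) :
    hurwitz (G := G) i * hurwitz j * hurwitz i = hurwitz j * hurwitz i * hurwitz j := by
  have h' : i.succ = j.castSucc := Fin.ext h
  ext x k
  simp only [Equiv.Perm.mul_apply, hurwitz, Equiv.coe_fn_mk, h']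
  simp only [Fin.ext_iff, Fin.val_castSucc, Fin.val_succ]
  split_ifs <;> first | omega | rfl | simp [mul_assoc]

/-- The Hurwitz action of the braid group `B_n` on `n`-tuples of elements of `G`. -/
def hurwitzHom (G : Type*) [Group G] (n : ℕ) :
    BraidGroup n →* Equiv.Perm (Fin (n - 1 + 1) → G) :=
  PresentedGroup.toGroup (f := hurwitz) <| by
    rintro _ (⟨i, j, h, rfl⟩ | ⟨i, j, h, rfl⟩)
    · simp only [map_mul, map_inv, FreeGroup.lift_apply_of, hurwitz_comm h]
      group
    · simp only [map_mul, map_inv, FreeGroup.lift_apply_of, hurwitz_braid h, mul_inv_cancel]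

@[simp] theorem hurwitzHom_σ (G : Type*) [Group G] (n : ℕ) (i : Fin (n - 1)) :
    hurwitzHom G n (σ i) = hurwitz i :=
  PresentedGroup.toGroup.of _

open DihedralGroup in
theorem not_commute_a_b : a * b ≠ b * a := by
  intro h
  have := congrArg (fun g => hurwitzHom (DihedralGroup 3) 5 g ![sr 0, 1, sr 0, r 1, 1] 0) h
  simp only [a, b, ψ₁, ψ₂, s₁, s₂, s₃, s₄, map_mul, map_inv, map_pow, hurwitzHom_σ] at this
  revert this
  decide +kernel

open Matrix

variable {R n : Type*} [CommRing R] [Fintype n] [DecidableEq n]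

theorem commute_of_sub_one_eq_vecMulVec {A B : Matrix n n R} {c d : R} {u v : n → R}
    (hd : IsUnit d) (hA : d • (A - 1) = vecMulVec u v)
    (hu : B *ᵥ u = c • u) (hv : v ᵥ* B = c • v) : A * B = B * A := by
  have h : d • ((A - 1) * B) = d • (B * (A - 1)) := by
    rw [← Matrix.smul_mul, ← Matrix.mul_smul, hA, vecMulVec_mul, mul_vecMulVec, hu, hv,
      smul_vecMulVec, vecMulVec_smul]
  have := hd.smul_left_cancel.mp h
  simpa [sub_mul, mul_sub] using this

theorem conj_commute_conj {M N S D : GL n R} {c d : R} {p q u v z : n → R}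
    (hd : IsUnit d) (hS : d • (S.val - 1) = vecMulVec p q)
    (hu : M.val *ᵥ u = p) (hv : q ᵥ* M.val = v)
    (hDu : D.val *ᵥ (N.val *ᵥ u) = c • (N.val *ᵥ u))
    (hz : z ᵥ* N.val = v) (hzD : z ᵥ* D.val = c • z) :
    (M⁻¹ * S * M) * (N⁻¹ * D * N) = (N⁻¹ * D * N) * (M⁻¹ * S * M) := by
  have hM : (M⁻¹).val * M.val = 1 := by rw [← Units.val_mul, inv_mul_cancel, Units.val_one]
  have hN : (N⁻¹).val * N.val = 1 := by rw [← Units.val_mul, inv_mul_cancel, Units.val_one]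
  have hN' : N.val * (N⁻¹).val = 1 := by rw [← Units.val_mul, mul_inv_cancel, Units.val_one]
  refine Units.ext (commute_of_sub_one_eq_vecMulVec (c := c) (u := u) (v := v) hd ?_ ?_ ?_)
  · have h : ((M⁻¹ * S * M : GL n R) : Matrix n n R) - 1 = (M⁻¹).val * (S.val - 1) * M.val := by
      rw [mul_sub, sub_mul, mul_one, hM, Units.val_mul, Units.val_mul]
    rw [h, ← Matrix.smul_mul, ← Matrix.mul_smul, hS, mul_vecMulVec, vecMulVec_mul, hv, ← hu, mulVec_mulVec, hM,
      one_mulVec]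
  · rw [Units.val_mul, Units.val_mul, ← mulVec_mulVec, ← mulVec_mulVec, hDu, mulVec_smul,
      mulVec_mulVec, hN, one_mulVec]
  · rw [Units.val_mul, Units.val_mul, ← vecMul_vecMul, ← vecMul_vecMul, ← hz, vecMul_vecMul z, hN',
      vecMul_one, hzD, smul_vecMul]

theorem GL_inv_mulVec_eq {B : GL n R} {x y : n → R} (h : B.val *ᵥ y = x) :
    (B⁻¹).val *ᵥ x = y := by
  rw [← h, mulVec_mulVec, ← Units.val_mul, inv_mul_cancel, Units.val_one, one_mulVec]

theorem GL_vecMul_inv_eq {B : GL n R} {x y : n → R} (h : y ᵥ* B.val = x) :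
    x ᵥ* (B⁻¹).val = y := by
  rw [← h, vecMul_vecMul, ← Units.val_mul, mul_inv_cancel, Units.val_one, vecMul_one]

theorem vec_four_ext {α : Type*} {x₀ x₁ x₂ x₃ y₀ y₁ y₂ y₃ : α} (h₀ : x₀ = y₀) (h₁ : x₁ = y₁)
    (h₂ : x₂ = y₂) (h₃ : x₃ = y₃) : ![x₀, x₁, x₂, x₃] = ![y₀, y₁, y₂, y₃] := by
  rw [h₀, h₁, h₂, h₃]

local notation "t" => (T 1 : Λ)

section BurauAction

variable (x₀ x₁ x₂ x₃ : Λ)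

theorem burauMatrix_four_zero_mulVec :
    burauMatrix 4 0 *ᵥ ![x₀, x₁, x₂, x₃] = ![-t * x₀ + x₁, x₁, x₂, x₃] := by
  ext i : 1; fin_cases i <;> simp [mulVec, dotProduct, Fin.sum_univ_four, burauMatrix]

theorem burauMatrix_four_one_mulVec :
    burauMatrix 4 1 *ᵥ ![x₀, x₁, x₂, x₃] = ![x₀, t * x₀ - t * x₁ + x₂, x₂, x₃] := by
  ext i : 1; fin_cases i <;> simp [mulVec, dotProduct, Fin.sum_univ_four, burauMatrix,
    sub_eq_add_neg]

theorem burauMatrix_four_two_mulVec :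
    burauMatrix 4 2 *ᵥ ![x₀, x₁, x₂, x₃] = ![x₀, x₁, t * x₁ - t * x₂ + x₃, x₃] := by
  ext i : 1; fin_cases i <;> simp [mulVec, dotProduct, Fin.sum_univ_four, burauMatrix,
    sub_eq_add_neg]

theorem burauMatrix_four_three_mulVec :
    burauMatrix 4 3 *ᵥ ![x₀, x₁, x₂, x₃] = ![x₀, x₁, x₂, t * x₂ - t * x₃] := by
  ext i : 1; fin_cases i <;> simp [mulVec, dotProduct, Fin.sum_univ_four, burauMatrix,
    sub_eq_add_neg]

theorem vecMul_burauMatrix_four_zero :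
    ![x₀, x₁, x₂, x₃] ᵥ* burauMatrix 4 0 = ![-(x₀ * t), x₀ + x₁, x₂, x₃] := by
  ext i : 1; fin_cases i <;> simp [vecMul, dotProduct, Fin.sum_univ_four, burauMatrix]

theorem vecMul_burauMatrix_four_one :
    ![x₀, x₁, x₂, x₃] ᵥ* burauMatrix 4 1 = ![x₀ + x₁ * t, -(x₁ * t), x₁ + x₂, x₃] := by
  ext i : 1; fin_cases i <;> simp [vecMul, dotProduct, Fin.sum_univ_four, burauMatrix]

theorem vecMul_burauMatrix_four_two :
    ![x₀, x₁, x₂, x₃] ᵥ* burauMatrix 4 2 = ![x₀, x₁ + x₂ * t, -(x₂ * t), x₂ + x₃] := by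
  ext i : 1; fin_cases i <;> simp [vecMul, dotProduct, Fin.sum_univ_four, burauMatrix]

theorem vecMul_burauMatrix_four_three :
    ![x₀, x₁, x₂, x₃] ᵥ* burauMatrix 4 3 = ![x₀, x₁, x₂ + x₃ * t, -(x₃ * t)] := by
  ext i : 1; fin_cases i <;> simp [vecMul, dotProduct, Fin.sum_univ_four, burauMatrix]

theorem burauMatrix_four_three_sub_one :
    burauMatrix 4 3 - 1 = vecMulVec ![0, 0, 0, 1] ![0, 0, t, -t - 1] := by
  ext i j : 2
  fin_cases i <;> fin_cases j <;> simp [vecMulVec_apply, burauMatrix]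

end BurauAction

set_option linter.unusedSimpArgs false in
theorem burau_conj_commute {g₁ g₂ g₃ g₄ : GL (Fin 4) Λ}
    (h₁ : g₁.val = burauMatrix 4 0) (h₂ : g₂.val = burauMatrix 4 1)
    (h₃ : g₃.val = burauMatrix 4 2) (h₄ : g₄.val = burauMatrix 4 3)
    {M N D : GL (Fin 4) Λ} (hM : M = g₃⁻¹ * g₂ * g₁ ^ 2 * g₂ * g₄ ^ 3 * g₃ * g₂)
    (hN : N = g₄⁻¹ * g₃ * g₂ * (g₁ ^ 2)⁻¹ * g₂ * g₁ ^ 2 * g₂ ^ 2 * g₁ * g₄ ^ 5)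
    (hD : D = g₄ * g₃ * g₂ * g₁ ^ 2 * g₂ * g₃ * g₄) :
    (M⁻¹ * g₄ * M) * (N⁻¹ * D * N) = (N⁻¹ * D * N) * (M⁻¹ * g₄ * M) := by
  let p : Fin 4 → Λ := ![0, 0, 0, t ^ 6]
  let q : Fin 4 → Λ := ![0, 0, t ^ 6, -t ^ 6 - t ^ 5]
  let u : Fin 4 → Λ := ![t ^ 4 - t ^ 3, t ^ 4 - 2 * t ^ 3 + t ^ 2 - t, t ^ 5 - t ^ 4 - t ^ 2,
    t ^ 6 - t ^ 5 + t ^ 4 - t ^ 3]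
  let y : Fin 4 → Λ := ![-t ^ 8 + 3 * t ^ 7 - 5 * t ^ 6 + 6 * t ^ 5 - 6 * t ^ 4 + 5 * t ^ 3
      - 4 * t ^ 2 + 2 * t - 1,
    -t ^ 9 + 2 * t ^ 8 - 2 * t ^ 7 + t ^ 6 - t ^ 2,
    t ^ 5 - t ^ 4 - t ^ 2,
    -t ^ 11 + 2 * t ^ 10 - 3 * t ^ 9 + 3 * t ^ 8 - 3 * t ^ 7 + 3 * t ^ 6 - 2 * t ^ 5 + t ^ 4 - t ^ 3]
  let w : Fin 4 → Λ := ![-t ^ 8 + 3 * t ^ 7 - 5 * t ^ 6 + 6 * t ^ 5 - 6 * t ^ 4 + 5 * t ^ 3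
      - 4 * t ^ 2 + 2 * t - 1,
    t ^ 10 - 3 * t ^ 9 + 5 * t ^ 8 - 6 * t ^ 7 + 6 * t ^ 6 - 5 * t ^ 5 + 4 * t ^ 4 - 3 * t ^ 3
      + t ^ 2 - t,
    -t ^ 10 + 2 * t ^ 9 - 3 * t ^ 8 + 3 * t ^ 7 - 3 * t ^ 6 + 3 * t ^ 5 - 2 * t ^ 4 + t ^ 3 - t ^ 2,
    0]
  let r : Fin 4 → Λ := ![0, t ^ 6, -t ^ 5, -t ^ 6]
  let v : Fin 4 → Λ := ![-t ^ 11 + t ^ 10 - t ^ 9 + t ^ 8 - t ^ 7,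
    t ^ 11 - t ^ 10 + t ^ 9 - t ^ 8 + t ^ 7, t ^ 9, -t ^ 7 + t ^ 6 - t ^ 5]
  let x : Fin 4 → Λ := ![t ^ 10 - t ^ 9 + t ^ 8 - t ^ 7 + t ^ 6,
    -t ^ 9 + 2 * t ^ 8 - 3 * t ^ 7 + 4 * t ^ 6 - 4 * t ^ 5 + 3 * t ^ 4 - 2 * t ^ 3 + t ^ 2,
    t ^ 10 - t ^ 9 + 2 * t ^ 8 - 2 * t ^ 7 + 2 * t ^ 6 - 2 * t ^ 5 + t ^ 4 - t ^ 3 + t ^ 2 - t,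
    t ^ 2 - t + 1]
  let z : Fin 4 → Λ := ![t ^ 12 - 2 * t ^ 11 + 3 * t ^ 10 - 4 * t ^ 9 + 5 * t ^ 8 - 5 * t ^ 7
      + 5 * t ^ 6 - 4 * t ^ 5 + 3 * t ^ 4 - 2 * t ^ 3 + t ^ 2,
    t ^ 10 - t ^ 9 + 2 * t ^ 8 - 2 * t ^ 7 + 2 * t ^ 6 - 2 * t ^ 5 + t ^ 4 - t ^ 3 + t ^ 2 - t,
    t ^ 9 - 2 * t ^ 8 + 3 * t ^ 7 - 5 * t ^ 6 + 6 * t ^ 5 - 6 * t ^ 4 + 6 * t ^ 3 - 4 * t ^ 2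
      + 2 * t,
    -t ^ 9 + t ^ 8 - 2 * t ^ 7 + 3 * t ^ 6 - 3 * t ^ 5 + 3 * t ^ 4 - 3 * t ^ 3 + 2 * t ^ 2 - t]
  let z' : Fin 4 → Λ := ![t ^ 12 - 2 * t ^ 11 + 3 * t ^ 10 - 4 * t ^ 9 + 5 * t ^ 8 - 5 * t ^ 7
      + 5 * t ^ 6 - 4 * t ^ 5 + 3 * t ^ 4 - 2 * t ^ 3 + t ^ 2,
    t ^ 10 - t ^ 9 + 2 * t ^ 8 - 2 * t ^ 7 + 2 * t ^ 6 - 2 * t ^ 5 + t ^ 4 - t ^ 3 + t ^ 2 - t,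
    -t ^ 8 + t ^ 7 - 2 * t ^ 6 + 3 * t ^ 5 - 3 * t ^ 4 + 3 * t ^ 3 - 2 * t ^ 2 + t,
    t ^ 8 - t ^ 7 + 2 * t ^ 6 - 3 * t ^ 5 + 3 * t ^ 4 - 3 * t ^ 3 + 3 * t ^ 2 - 2 * t + 1]
  have hMu : M.val *ᵥ u = p := by
    have : M = g₃⁻¹ * (g₂ * g₁ ^ 2 * g₂ * g₄ ^ 3 * g₃ * g₂) := by simp only [hM, mul_assoc]
    rw [this, Units.val_mul, ← mulVec_mulVec]
    refine GL_inv_mulVec_eq ?_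
    simp only [Units.val_mul, pow_succ, pow_zero, one_mul, h₁, h₂, h₃, h₄,
      ← mulVec_mulVec, p, u, y, w, burauMatrix_four_zero_mulVec, burauMatrix_four_one_mulVec,
      burauMatrix_four_two_mulVec, burauMatrix_four_three_mulVec]
    refine vec_four_ext ?_ ?_ ?_ ?_ <;> ring
  have hNu : N.val *ᵥ u = w := by
    have : N = g₄⁻¹ * ((g₃ * g₂) * ((g₁ ^ 2)⁻¹ *
        (g₂ * g₁ ^ 2 * g₂ ^ 2 * g₁ * g₄ ^ 5))) := by simp only [hN, mul_assoc]
    rw [this, Units.val_mul, ← mulVec_mulVec, Units.val_mul, ← mulVec_mulVec,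
      Units.val_mul (g₁ ^ 2)⁻¹, ← mulVec_mulVec]
    have hy : ((g₁ ^ 2)⁻¹).val *ᵥ ((g₂ * g₁ ^ 2 * g₂ ^ 2 * g₁ * g₄ ^ 5).val *ᵥ u) = y := by
      refine GL_inv_mulVec_eq ?_
      simp only [Units.val_mul, pow_succ, pow_zero, one_mul, h₁, h₂, h₃, h₄,
        ← mulVec_mulVec, p, u, y, w, burauMatrix_four_zero_mulVec, burauMatrix_four_one_mulVec,
        burauMatrix_four_two_mulVec, burauMatrix_four_three_mulVec]
      refine vec_four_ext ?_ ?_ ?_ ?_ <;> ring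
    rw [hy]
    refine GL_inv_mulVec_eq ?_
    simp only [Units.val_mul, pow_succ, pow_zero, one_mul, h₁, h₂, h₃, h₄,
      ← mulVec_mulVec, p, u, y, w, burauMatrix_four_zero_mulVec, burauMatrix_four_one_mulVec,
      burauMatrix_four_two_mulVec, burauMatrix_four_three_mulVec]
    refine vec_four_ext ?_ ?_ ?_ ?_ <;> ring
  have hqM : q ᵥ* M.val = v := by
    have hr : q ᵥ* (g₃⁻¹).val = r := by
      refine GL_vecMul_inv_eq ?_
      simp only [Units.val_mul, pow_succ, pow_zero, one_mul, h₁, h₂, h₃, h₄, ← vecMul_vecMul,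
        q, r, v, x, z, z', vecMul_burauMatrix_four_zero, vecMul_burauMatrix_four_one,
        vecMul_burauMatrix_four_two, vecMul_burauMatrix_four_three]
      refine vec_four_ext ?_ ?_ ?_ ?_ <;> ring
    have : M = g₃⁻¹ * (g₂ * g₁ ^ 2 * g₂ * g₄ ^ 3 * g₃ * g₂) := by simp only [hM, mul_assoc]
    rw [this, Units.val_mul, ← vecMul_vecMul, hr]
    simp only [Units.val_mul, pow_succ, pow_zero, one_mul, h₁, h₂, h₃, h₄, ← vecMul_vecMul,
      q, r, v, x, z, z', vecMul_burauMatrix_four_zero, vecMul_burauMatrix_four_one,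
      vecMul_burauMatrix_four_two, vecMul_burauMatrix_four_three]
    refine vec_four_ext ?_ ?_ ?_ ?_ <;> ring
  have hzN : z ᵥ* N.val = v := by
    have : N = g₄⁻¹ * ((g₃ * g₂) * ((g₁ ^ 2)⁻¹ *
        (g₂ * g₁ ^ 2 * g₂ ^ 2 * g₁ * g₄ ^ 5))) := by simp only [hN, mul_assoc]
    have hz' : z ᵥ* (g₄⁻¹).val = z' := by
      refine GL_vecMul_inv_eq ?_
      simp only [Units.val_mul, pow_succ, pow_zero, one_mul, h₁, h₂, h₃, h₄, ← vecMul_vecMul,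
        q, r, v, x, z, z', vecMul_burauMatrix_four_zero, vecMul_burauMatrix_four_one,
        vecMul_burauMatrix_four_two, vecMul_burauMatrix_four_three]
      refine vec_four_ext ?_ ?_ ?_ ?_ <;> ring
    have hx : (z' ᵥ* (g₃ * g₂).val) ᵥ* ((g₁ ^ 2)⁻¹).val = x := by
      refine GL_vecMul_inv_eq ?_
      simp only [Units.val_mul, pow_succ, pow_zero, one_mul, h₁, h₂, h₃, h₄, ← vecMul_vecMul,
        q, r, v, x, z, z', vecMul_burauMatrix_four_zero, vecMul_burauMatrix_four_one,
        vecMul_burauMatrix_four_two, vecMul_burauMatrix_four_three]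
      refine vec_four_ext ?_ ?_ ?_ ?_ <;> ring
    rw [this, Units.val_mul, ← vecMul_vecMul, Units.val_mul, ← vecMul_vecMul,
      Units.val_mul (g₁ ^ 2)⁻¹, ← vecMul_vecMul, hz', hx]
    simp only [Units.val_mul, pow_succ, pow_zero, one_mul, h₁, h₂, h₃, h₄, ← vecMul_vecMul,
      q, r, v, x, z, z', vecMul_burauMatrix_four_zero, vecMul_burauMatrix_four_one,
      vecMul_burauMatrix_four_two, vecMul_burauMatrix_four_three]
    refine vec_four_ext ?_ ?_ ?_ ?_ <;> ring
  refine conj_commute_conj (c := t) (d := t ^ 11) ((isUnit_T 1).pow 11) ?_ hMu hqM ?_ hzN ?_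
  · have hp : p = t ^ 6 • ![0, 0, 0, 1] := by
      simp only [p, smul_cons, smul_empty, smul_eq_mul]
      refine vec_four_ext ?_ ?_ ?_ ?_ <;> ring
    have hq : q = t ^ 5 • ![0, 0, t, -t - 1] := by
      simp only [q, smul_cons, smul_empty, smul_eq_mul]
      refine vec_four_ext ?_ ?_ ?_ ?_ <;> ring
    rw [h₄, burauMatrix_four_three_sub_one, hp, hq, smul_vecMulVec, vecMulVec_smul, smul_smul,
      ← pow_add]
  · rw [hNu, hD]
    simp only [Units.val_mul, pow_succ, pow_zero, one_mul, h₁, h₂, h₃, h₄,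
      ← mulVec_mulVec, smul_cons, smul_empty, smul_eq_mul, p, u, y, w,
      burauMatrix_four_zero_mulVec, burauMatrix_four_one_mulVec,
      burauMatrix_four_two_mulVec, burauMatrix_four_three_mulVec]
    refine vec_four_ext ?_ ?_ ?_ ?_ <;> ring
  · rw [hD]
    simp only [Units.val_mul, pow_succ, pow_zero, one_mul, h₁, h₂, h₃, h₄, ← vecMul_vecMul,
      smul_cons, smul_empty, smul_eq_mul,
      q, r, v, x, z, z', vecMul_burauMatrix_four_zero, vecMul_burauMatrix_four_one,
      vecMul_burauMatrix_four_two, vecMul_burauMatrix_four_three]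
    refine vec_four_ext ?_ ?_ ?_ ?_ <;> ring

/-- The Burau images of `a` and `b` commute in `GL₄(ℤ[t,t⁻¹])`, even though `a` and `b`
do not commute in `B₅`. -/
theorem burau_images_commute_but_braids_do_not
    (ρ : BraidGroup 5 →* GL (Fin (5 - 1)) Λ)
    (hρ : ∀ i : Fin (5 - 1),
      (ρ (σ i) : Matrix (Fin (5 - 1)) (Fin (5 - 1)) Λ) = burauMatrix (5 - 1) i) :
    ρ a * ρ b = ρ b * ρ a ∧ a * b ≠ b * a := by
  refine ⟨?_, not_commute_a_b⟩
  simp only [a, b, map_mul, map_inv]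
  refine burau_conj_commute (hρ 0) (hρ 1) (hρ 2) (hρ 3) ?_ ?_ ?_ <;>
    simp only [ψ₁, ψ₂, map_mul, map_inv, map_pow] <;> rfl
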